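/- Let α > −1 and γ > 0. There exist constants C₁, C₂ > 0 such that for all z, u, ζ ∈ 𝔹_n satisfying ϱ(z,ζ) > C₁ ϱ(u,ζ), one has |(1−⟨w,u⟩)^{−(n+1+α)} − (1−⟨w,ζ⟩)^{−(n+1+α)}| ≤ C₂ ϱ(u,ζ)^{1/2} / ϱ(z,ζ)^{n+1+α+1/2} for every w ∈ D(z,γ). -/

import Mathlib

open MeasureTheory Filter Topology
open scoped Classical ENNReal

noncomputable section

/-- `ℂⁿ` with the Euclidean norm. -/
abbrev En (n : ℕ) := EuclideanSpace ℂ (Fin n)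

instance (n : ℕ) : MeasurableSpace (En n) := borel _
instance (n : ℕ) : BorelSpace (En n) := ⟨rfl⟩

/-- The Lebesgue volume measure on `ℂⁿ`. -/
def vol (n : ℕ) : Measure (En n) := Measure.addHaar

/-- The open unit ball `𝔹ₙ` of `ℂⁿ`. -/
def uball (n : ℕ) : Set (En n) := Metric.ball 0 1

/-- The Hermitian pairing `⟨z,w⟩ = ∑ⱼ zⱼ * conj wⱼ`. -/
def herm {n : ℕ} (z w : En n) : ℂ := ∑ j, z j * (starRingEnd ℂ) (w j)

/-- The orthogonal projection `P_z w` onto the line spanned by `z`. -/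
def prj {n : ℕ} (z w : En n) : En n :=
  if z = 0 then 0 else (herm w z / herm z z) • z

/-- The Möbius automorphism `φ_z` of the unit ball. -/
def mobius {n : ℕ} (z w : En n) : En n :=
  ((1 : ℂ) / (1 - herm w z)) •
    (z - prj z w - ((Real.sqrt (1 - ‖z‖ ^ 2) : ℝ) : ℂ) • (w - prj z w))

/-- The Bergman metric `β(z,w)`. -/
def bmet {n : ℕ} (z w : En n) : ℝ :=
  (1 / 2) * Real.log ((1 + ‖mobius z w‖) / (1 - ‖mobius z w‖))

/-- The Bergman metric ball `D(z,γ)`. -/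
def Dball {n : ℕ} (z : En n) (γ : ℝ) : Set (En n) :=
  {w | w ∈ uball n ∧ bmet z w < γ}

/-- The normalizing constant `c_α`. -/
def cnorm (n : ℕ) (α : ℝ) : ℝ :=
  if -1 < α then Real.Gamma (n + α + 1) / (n.factorial * Real.Gamma (α + 1)) else 1

/-- The weighted measure `dv_α = c_α (1-|z|²)^α dv` on the unit ball. -/
def measA (n : ℕ) (α : ℝ) : Measure (En n) :=
  ((vol n).restrict (uball n)).withDensity
    (fun z => ENNReal.ofReal (cnorm n α * (1 - ‖z‖ ^ 2) ^ α))

/-- The invariant measure `dτ = (1-|z|²)^{-(n+1)} dv` on the unit ball. -/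
def measTau (n : ℕ) : Measure (En n) :=
  ((vol n).restrict (uball n)).withDensity
    (fun z => ENNReal.ofReal ((1 - ‖z‖ ^ 2) ^ (-((n : ℝ) + 1))))

/-- The Bergman space (quasi-)norm `‖f‖_{p,α}`, valued in `ℝ≥0∞`. -/
def apnorm (n : ℕ) (p α : ℝ) (f : En n → ℂ) : ℝ≥0∞ :=
  (∫⁻ z, ENNReal.ofReal (‖f z‖ ^ p) ∂measA n α) ^ (1 / p)

/-- The radial derivative `Rf(z) = ∑ z_k ∂f/∂z_k = Df(z)[z]`. -/
def radD {n : ℕ} (f : En n → ℂ) (z : En n) : ℂ := fderiv ℂ f z z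

/-- Iterated radial derivative `R^k f`. -/
def radIter {n : ℕ} : ℕ → (En n → ℂ) → En n → ℂ
  | 0, f => f
  | (k + 1), f => radD (radIter k f)

/-- The pseudo-metric `ϱ` on the unit ball. -/
def rho {n : ℕ} (z w : En n) : ℝ :=
  if z ≠ 0 ∧ w ≠ 0 then
    |‖z‖ - ‖w‖| + ‖1 - herm z w / ((‖z‖ : ℂ) * (‖w‖ : ℂ))‖
  else ‖z‖ + ‖w‖

/-- The weighted Bergman kernel `K_α(z,w) = (1-⟨z,w⟩)^{-(n+1+α)}`. -/
def bergKer {n : ℕ} (α : ℝ) (z w : En n) : ℂ :=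
  (1 - herm z w) ^ ((-(((n : ℝ) + 1 + α)) : ℂ))


lemma herm_eq {n : ℕ} (z w : En n) : herm z w = inner ℂ w z := by
  simp [herm, PiLp.inner_apply]

lemma aux_unit_perp {n : ℕ} (e x : En n) (he : ‖e‖ = 1) :
    ‖x - (inner ℂ e x : ℂ) • e‖ ^ 2 = ‖x‖ ^ 2 - ‖(inner ℂ e x : ℂ)‖ ^ 2 := by
  have h1 : (inner ℂ e (x - (inner ℂ e x : ℂ) • e) : ℂ) = 0 := by
    rw [inner_sub_right, inner_smul_right, inner_self_eq_norm_sq_to_K, he]; simp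
  have h2 := norm_add_sq_eq_norm_sq_add_norm_sq_of_inner_eq_zero
    (𝕜 := ℂ) ((inner ℂ e x : ℂ) • e) (x - (inner ℂ e x : ℂ) • e) (by
      rw [inner_smul_left, h1]; simp)
  rw [add_sub_cancel, norm_smul, he] at h2
  nlinarith

lemma rho_nonneg {n : ℕ} (z w : En n) : 0 ≤ rho z w := by
  unfold rho; split_ifs <;> positivity

/-- `ϱ(z,w) ≤ 3|1-⟨z,w⟩|`. -/
lemma rho_le {n : ℕ} (z w : En n) (hz : ‖z‖ < 1) (hw : ‖w‖ < 1) :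
    rho z w ≤ 3 * ‖1 - herm z w‖ := by
  unfold rho
  split_ifs with h
  · obtain ⟨h1, h2⟩ := h
    have hz0 : 0 < ‖z‖ := norm_pos_iff.mpr h1
    have hw0 : 0 < ‖w‖ := norm_pos_iff.mpr h2
    have hcs : ‖herm z w‖ ≤ ‖z‖ * ‖w‖ := by
      rw [herm_eq, mul_comm]; exact norm_inner_le_norm _ _
    have hrev : 1 - ‖herm z w‖ ≤ ‖1 - herm z w‖ := by
      simpa using norm_sub_norm_le (1 : ℂ) (herm z w)
    set t : ℝ := ‖z‖ * ‖w‖ with ht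
    have ht0 : 0 < t := by positivity
    have ht1 : t ≤ 1 := by nlinarith
    have hA : |‖z‖ - ‖w‖| ≤ ‖1 - herm z w‖ := by
      rw [abs_le]; constructor <;> nlinarith
    set c : ℂ := herm z w / ((‖z‖ : ℂ) * (‖w‖ : ℂ)) with hc
    have hc1 : ‖c‖ ≤ 1 := by
      rw [hc, norm_div, norm_mul]; simp only [Complex.norm_real, norm_norm]
      rw [div_le_one ht0]; exact hcs
    have hct : herm z w = t * c := by
      rw [hc, ht]; push_cast
      have a1 : (‖z‖ : ℂ) ≠ 0 := by exact_mod_cast hz0.ne'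
      have a2 : (‖w‖ : ℂ) ≠ 0 := by exact_mod_cast hw0.ne'
      field_simp
    have hB : ‖1 - c‖ ≤ ‖1 - herm z w‖ + (1 - t) := by
      have : 1 - c = (1 - herm z w) - ((1 - t : ℝ) : ℂ) * c := by
        rw [hct]; push_cast; ring
      rw [this]
      refine (norm_sub_le _ _).trans ?_
      rw [norm_mul, Complex.norm_real, Real.norm_of_nonneg (by linarith)]
      nlinarith
    linarith
  · have h0 : z = 0 ∨ w = 0 := by tauto
    rcases h0 with rfl | rfl
    · simp [herm_eq]; linarith
    · simp [herm_eq]; linarith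

/-- Key decomposition. -/
lemma key {n : ℕ} (w u ζ : En n) (hw : ‖w‖ < 1) (hu : ‖u‖ < 1) (hζ : ‖ζ‖ < 1) :
    ‖herm w u - herm w ζ‖ ≤ rho u ζ + 2 * Real.sqrt (rho u ζ * ‖1 - herm w ζ‖) := by
  have hs : 0 ≤ Real.sqrt (rho u ζ * ‖1 - herm w ζ‖) := Real.sqrt_nonneg _
  by_cases hu0 : u = 0
  · subst hu0
    have : ‖herm w ζ‖ ≤ ‖ζ‖ * ‖w‖ := by rw [herm_eq]; exact norm_inner_le_norm _ _
    have h1 : rho 0 ζ = ‖ζ‖ := by simp [rho]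
    have h2 : herm w 0 = 0 := by simp [herm_eq]
    rw [h2, zero_sub, norm_neg]
    nlinarith [norm_nonneg ζ]
  by_cases hζ0 : ζ = 0
  · subst hζ0
    have : ‖herm w u‖ ≤ ‖u‖ * ‖w‖ := by rw [herm_eq]; exact norm_inner_le_norm _ _
    have h1 : rho u 0 = ‖u‖ := by simp [rho]
    have h2 : herm w 0 = 0 := by simp [herm_eq]
    rw [h2] at hs ⊢; rw [sub_zero (herm w u)]
    nlinarith [norm_nonneg u]
  have hU : 0 < ‖u‖ := norm_pos_iff.mpr hu0
  have hZ : 0 < ‖ζ‖ := norm_pos_iff.mpr hζ0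
  have aU : (‖u‖ : ℂ) ≠ 0 := by exact_mod_cast hU.ne'
  have aZ : (‖ζ‖ : ℂ) ≠ 0 := by exact_mod_cast hZ.ne'
  have hd : rho u ζ = |‖u‖ - ‖ζ‖| + ‖1 - herm u ζ / ((‖u‖ : ℂ) * (‖ζ‖ : ℂ))‖ := by
    simp [rho, hu0, hζ0]
  set d := rho u ζ with hdd
  set c : ℂ := herm u ζ / ((‖u‖ : ℂ) * (‖ζ‖ : ℂ)) with hc
  have hd0 : 0 ≤ d := rho_nonneg _ _
  have habs := abs_nonneg (‖u‖ - ‖ζ‖)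
  obtain ⟨e, he⟩ : ∃ e : En n, e = ((‖ζ‖ : ℂ)⁻¹) • ζ := ⟨_, rfl⟩
  have he1 : ‖e‖ = 1 := by
    rw [he, norm_smul, norm_inv, Complex.norm_real, norm_norm]
    exact inv_mul_cancel₀ hZ.ne'
  have hζe : ζ = (‖ζ‖ : ℂ) • e := by
    rw [he, smul_smul, mul_inv_cancel₀ aZ, one_smul]
  have hue : (inner ℂ e u : ℂ) = ‖u‖ * c := by
    rw [he, inner_smul_left, hc, herm_eq]; simp; field_simp
  have hcn : ‖c‖ ≤ 1 := by
    have : ‖(inner ℂ e u : ℂ)‖ ≤ ‖e‖ * ‖u‖ := norm_inner_le_norm _ _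
    rw [hue, norm_mul, he1, Complex.norm_real, norm_norm] at this
    by_contra hcc
    push Not at hcc
    nlinarith
  have hcr : 1 - ‖c‖ ≤ ‖1 - c‖ := by simpa using norm_sub_norm_le (1 : ℂ) c
  have hwz : herm w ζ = ‖ζ‖ * inner ℂ e w := by
    rw [herm_eq]; conv_lhs => rw [hζe]
    rw [inner_smul_left]; simp
  set p := u - (inner ℂ e u : ℂ) • e with hp
  set q := w - (inner ℂ e w : ℂ) • e with hq
  have hpn : ‖p‖ ^ 2 ≤ 2 * d := by
    rw [hp, aux_unit_perp e u he1, hue, norm_mul, Complex.norm_real, norm_norm]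
    have : ‖u‖ ^ 2 * (1 - ‖c‖ ^ 2) ≤ 1 * (1 - ‖c‖ ^ 2) := by
      apply mul_le_mul_of_nonneg_right <;> nlinarith [norm_nonneg c]
    nlinarith [norm_nonneg c]
  have hbe : ‖herm w ζ‖ ≤ ‖(inner ℂ e w : ℂ)‖ := by
    rw [hwz, norm_mul, Complex.norm_real, norm_norm]
    nlinarith [norm_nonneg (inner ℂ e w : ℂ)]
  have hcs : ‖herm w ζ‖ ≤ 1 := by
    have : ‖herm w ζ‖ ≤ ‖ζ‖ * ‖w‖ := by rw [herm_eq]; exact norm_inner_le_norm _ _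
    nlinarith
  have hAr : 1 - ‖herm w ζ‖ ≤ ‖1 - herm w ζ‖ := by
    simpa using norm_sub_norm_le (1 : ℂ) (herm w ζ)
  have hqn : ‖q‖ ^ 2 ≤ 2 * ‖1 - herm w ζ‖ := by
    rw [hq, aux_unit_perp e w he1]
    nlinarith [norm_nonneg (herm w ζ), norm_nonneg w]
  have hpe : (inner ℂ p e : ℂ) = 0 := by
    rw [hp, inner_sub_left, inner_smul_left, inner_self_eq_norm_sq_to_K, he1]; simp
  have hpq : (inner ℂ p w : ℂ) = inner ℂ p q := by
    rw [hq, inner_sub_right, inner_smul_right, hpe]; simp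
  have hsplit : u - ζ = ((‖u‖ * c - ‖ζ‖ : ℂ)) • e + p := by
    conv_lhs => rw [hζe]
    rw [hp, hue, sub_smul]; abel
  have hfirst : ‖(‖u‖ * c - ‖ζ‖ : ℂ)‖ ≤ d := by
    have : (‖u‖ * c - ‖ζ‖ : ℂ) = ((‖u‖ - ‖ζ‖ : ℝ) : ℂ) - ‖u‖ * (1 - c) := by
      push_cast; ring
    rw [this, hd]
    refine (norm_sub_le _ _).trans ?_
    rw [norm_mul, Complex.norm_real, Complex.norm_real, norm_norm, Real.norm_eq_abs]
    nlinarith [norm_nonneg (1 - c)]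
  have hew : ‖(inner ℂ e w : ℂ)‖ ≤ 1 := by
    have : ‖(inner ℂ e w : ℂ)‖ ≤ ‖e‖ * ‖w‖ := norm_inner_le_norm _ _
    rw [he1] at this; linarith
  have hpq2 : ‖p‖ * ‖q‖ ≤ 2 * Real.sqrt (d * ‖1 - herm w ζ‖) := by
    have h4 : ‖p‖ * ‖q‖ ≤ Real.sqrt (2 ^ 2 * (d * ‖1 - herm w ζ‖)) := by
      apply Real.le_sqrt_of_sq_le
      rw [mul_pow]
      calc ‖p‖ ^ 2 * ‖q‖ ^ 2 ≤ (2 * d) * (2 * ‖1 - herm w ζ‖) := by gcongr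
        _ = _ := by ring
    rwa [Real.sqrt_mul (by norm_num), Real.sqrt_sq (by norm_num)] at h4
  have : herm w u - herm w ζ = inner ℂ (u - ζ) w := by
    rw [herm_eq, herm_eq, inner_sub_left]
  rw [this, hsplit, inner_add_left, inner_smul_left, hpq]
  refine (norm_add_le _ _).trans ?_
  rw [norm_mul, RCLike.norm_conj]
  have h5 : ‖(inner ℂ p q : ℂ)‖ ≤ ‖p‖ * ‖q‖ := norm_inner_le_norm _ _
  have h6 : ‖(‖u‖ * c - ‖ζ‖ : ℂ)‖ * ‖(inner ℂ e w : ℂ)‖ ≤ d * 1 := by gcongr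
  linarith

/-- The Möbius identity. -/
lemma mobius_id {n : ℕ} (z w : En n) (hz : ‖z‖ < 1) (hw : ‖w‖ < 1) :
    (1 - ‖mobius z w‖ ^ 2) * ‖1 - herm w z‖ ^ 2 = (1 - ‖z‖ ^ 2) * (1 - ‖w‖ ^ 2) := by
  have hcs : ‖herm w z‖ ≤ ‖z‖ * ‖w‖ := by rw [herm_eq]; exact norm_inner_le_norm _ _
  have hAr : 1 - ‖herm w z‖ ≤ ‖1 - herm w z‖ := by
    simpa using norm_sub_norm_le (1 : ℂ) (herm w z)
  have hpos : 0 < ‖1 - herm w z‖ := by nlinarith [norm_nonneg z, norm_nonneg w]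
  by_cases hz0 : z = 0
  · subst hz0
    simp [mobius, prj, herm_eq]
  have hZ : 0 < ‖z‖ := norm_pos_iff.mpr hz0
  have aZ : (‖z‖ : ℂ) ≠ 0 := by exact_mod_cast hZ.ne'
  obtain ⟨e, he⟩ : ∃ e : En n, e = ((‖z‖ : ℂ)⁻¹) • z := ⟨_, rfl⟩
  have he1 : ‖e‖ = 1 := by
    rw [he, norm_smul, norm_inv, Complex.norm_real, norm_norm]
    exact inv_mul_cancel₀ hZ.ne'
  have hze : z = (‖z‖ : ℂ) • e := by
    rw [he, smul_smul, mul_inv_cancel₀ aZ, one_smul]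
  set a : ℂ := inner ℂ e w with ha
  have hwz : herm w z = ‖z‖ * a := by
    rw [herm_eq]; conv_lhs => rw [hze]
    rw [inner_smul_left]; simp [ha]
  have hprj : prj z w = a • e := by
    have h1 : herm z z = (‖z‖ : ℂ) ^ 2 := by
      rw [herm_eq, inner_self_eq_norm_sq_to_K]; simp
    rw [prj, if_neg hz0, hwz, h1]
    rw [he, smul_smul]; congr 1; field_simp
  set q := w - a • e with hq
  have hqn : ‖q‖ ^ 2 = ‖w‖ ^ 2 - ‖a‖ ^ 2 := aux_unit_perp e w he1
  have heq : (inner ℂ e q : ℂ) = 0 := by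
    rw [hq, inner_sub_right, inner_smul_right, inner_self_eq_norm_sq_to_K, he1]; simp [ha]
  set s := Real.sqrt (1 - ‖z‖ ^ 2) with hs
  have hs2 : s ^ 2 = 1 - ‖z‖ ^ 2 := Real.sq_sqrt (by nlinarith)
  have hv : z - prj z w - (s : ℂ) • (w - prj z w) = ((‖z‖ : ℂ) - a) • e + (-(s : ℂ)) • q := by
    rw [hprj, ← hq]; conv_lhs => rw [hze]
    simp only [sub_smul, neg_smul, norm_smul, Complex.norm_real, norm_norm, he1, mul_one]
    abel
  have hvn : ‖z - prj z w - (s : ℂ) • (w - prj z w)‖ ^ 2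
      = ‖(‖z‖ : ℂ) - a‖ ^ 2 + s ^ 2 * (‖w‖ ^ 2 - ‖a‖ ^ 2) := by
    rw [hv]
    have := norm_add_sq_eq_norm_sq_add_norm_sq_of_inner_eq_zero
      (𝕜 := ℂ) (((‖z‖ : ℂ) - a) • e) ((-(s : ℂ)) • q) (by
        rw [inner_smul_left, inner_smul_right, heq]; simp)
    rw [← hqn, sq, this, norm_smul, norm_smul, he1, norm_neg, Complex.norm_real, Real.norm_eq_abs,
      ← sq_abs s]
    ring
  have hm : ‖mobius z w‖ ^ 2 * ‖1 - herm w z‖ ^ 2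
      = ‖(‖z‖ : ℂ) - a‖ ^ 2 + s ^ 2 * (‖w‖ ^ 2 - ‖a‖ ^ 2) := by
    rw [← hvn, mobius, norm_smul, norm_div, norm_one]
    rw [← hs]
    field_simp
  rw [sub_mul, hm, hs2, hwz, one_mul]
  have e1 : ‖(1 : ℂ) - ‖z‖ * a‖ ^ 2 = (1 - ‖z‖ * a.re) ^ 2 + (‖z‖ * a.im) ^ 2 := by
    rw [Complex.sq_norm, Complex.normSq_apply]; simp; ring
  have e2 : ‖(‖z‖ : ℂ) - a‖ ^ 2 = (‖z‖ - a.re) ^ 2 + a.im ^ 2 := by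
    rw [Complex.sq_norm, Complex.normSq_apply]; simp; ring
  have e3 : ‖a‖ ^ 2 = a.re ^ 2 + a.im ^ 2 := by
    rw [Complex.sq_norm, Complex.normSq_apply]; ring
  rw [e1, e2, e3]; ring

/-- Comparability over Bergman balls. -/
lemma compar {n : ℕ} (γ : ℝ) (z w ζ : En n) (hz : ‖z‖ < 1) (hζ : ‖ζ‖ < 1)
    (hw : w ∈ Dball z γ) :
    ‖1 - herm z ζ‖ ≤ (1 + 12 * Real.exp (2 * γ) + 2 * Real.sqrt (12 * Real.exp (2 * γ)))
      * ‖1 - herm w ζ‖ := by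
  obtain ⟨hw1, hb⟩ := hw
  have hw1 : ‖w‖ < 1 := by simpa [uball] using hw1
  have hid := mobius_id z w hz hw1
  set m := ‖mobius z w‖ with hm
  have hm0 : 0 ≤ m := norm_nonneg _
  have hpz : 0 < 1 - ‖z‖ ^ 2 := by nlinarith [norm_nonneg z]
  have hpw : 0 < 1 - ‖w‖ ^ 2 := by nlinarith [norm_nonneg w]
  have hm1 : m < 1 := by
    by_contra h
    push Not at h
    have : (1 - m ^ 2) * ‖1 - herm w z‖ ^ 2 ≤ 0 :=
      mul_nonpos_of_nonpos_of_nonneg (by nlinarith) (by positivity)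
    have := mul_pos hpz hpw
    linarith
  set E := Real.exp (2 * γ) with hE
  have hE0 : 0 < E := Real.exp_pos _
  have hlt : (1 + m) / (1 - m) < E := by
    rw [hE, ← Real.log_lt_iff_lt_exp (by apply div_pos <;> linarith)]
    unfold bmet at hb; rw [← hm] at hb; linarith
  rw [div_lt_iff₀ (by linarith)] at hlt
  have hδ : 1 ≤ E * (1 - m ^ 2) := by nlinarith
  set X := ‖1 - herm w z‖ with hX
  have hcs : ‖herm w z‖ ≤ ‖z‖ * ‖w‖ := by rw [herm_eq]; exact norm_inner_le_norm _ _
  have hAr : 1 - ‖herm w z‖ ≤ X := by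
    simpa using norm_sub_norm_le (1 : ℂ) (herm w z)
  have hXz : 1 - ‖z‖ ^ 2 ≤ 2 * X := by nlinarith [norm_nonneg z, norm_nonneg w]
  have hX0 : 0 < X := by linarith
  have hcs2 : ‖herm w ζ‖ ≤ ‖ζ‖ * ‖w‖ := by rw [herm_eq]; exact norm_inner_le_norm _ _
  set A := ‖1 - herm w ζ‖ with hA
  have hAr2 : 1 - ‖herm w ζ‖ ≤ A := by
    simpa using norm_sub_norm_le (1 : ℂ) (herm w ζ)
  have hAw : 1 - ‖w‖ ^ 2 ≤ 2 * A := by nlinarith [norm_nonneg ζ, norm_nonneg w]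
  have hA0 : 0 < A := by linarith
  have hX4 : X ≤ 4 * E * A := by
    have h1 : X ^ 2 ≤ E * ((1 - ‖z‖ ^ 2) * (1 - ‖w‖ ^ 2)) := by
      rw [← hid]; nlinarith [sq_nonneg X]
    have h2 : (1 - ‖z‖ ^ 2) * (1 - ‖w‖ ^ 2) ≤ (2 * X) * (2 * A) := by gcongr
    have h3 : X * X ≤ (4 * E * A) * X := by nlinarith
    exact le_of_mul_le_mul_right h3 hX0
  have symm : ∀ a b : En n, ‖1 - herm a b‖ = ‖1 - herm b a‖ := by
    intro a b
    rw [herm_eq, herm_eq, ← inner_conj_symm, ← RCLike.norm_conj]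
    simp
  have hr : rho z w ≤ 12 * E * A := by
    have := rho_le z w hz hw1
    rw [symm z w] at this
    linarith
  have hk := key ζ z w hζ hz hw1
  rw [symm ζ w, ← hA] at hk
  have hsq : Real.sqrt (rho z w * A) ≤ Real.sqrt (12 * E) * A := by
    calc Real.sqrt (rho z w * A) ≤ Real.sqrt ((12 * E) * A ^ 2) := by
          apply Real.sqrt_le_sqrt; nlinarith
      _ = _ := by rw [Real.sqrt_mul (by positivity), Real.sqrt_sq hA0.le]
  rw [symm z ζ]
  have : ‖1 - herm ζ z‖ ≤ A + ‖herm ζ z - herm ζ w‖ := by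
    rw [hA, symm w ζ]
    have : 1 - herm ζ z = (1 - herm ζ w) - (herm ζ z - herm ζ w) := by ring
    rw [this]; exact norm_sub_le _ _
  nlinarith

lemma cpow_diff (s : ℝ) (hs : 0 < s) (A B : ℂ) (hA : 0 < A.re) (hB : 0 < B.re)
    (h : ‖B - A‖ ≤ ‖A‖ / 2) :
    ‖B ^ (-(s : ℂ)) - A ^ (-(s : ℂ))‖ ≤ s * (‖A‖ / 2) ^ (-s - 1) * ‖B - A‖ := by
  have hA0 : 0 < ‖A‖ := norm_pos_iff.mpr (by rintro rfl; simp at hA)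
  have hconv : Convex ℝ ({x : ℂ | 0 < x.re} ∩ Metric.closedBall A (‖A‖ / 2)) :=
    (convex_halfSpace_re_gt 0).inter (convex_closedBall _ _)
  refine hconv.norm_image_sub_le_of_norm_hasDerivWithin_le
    (f := fun x : ℂ => x ^ (-(s : ℂ)))
    (f' := fun x : ℂ => (-(s : ℂ)) * x ^ (-(s : ℂ) - 1)) ?_ ?_ ?_ ?_
  · rintro x ⟨hx, -⟩
    have := (hasDerivAt_id x).cpow_const (c := -(s : ℂ)) (Or.inl hx)
    simpa using this.hasDerivWithinAt
  · rintro x ⟨hx, hx2⟩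
    have hx3 : ‖A‖ / 2 ≤ ‖x‖ := by
      have h1 : ‖x - A‖ ≤ ‖A‖ / 2 := by simpa [dist_eq_norm] using hx2
      have h2 := norm_sub_norm_le A x
      rw [norm_sub_rev] at h2; linarith
    have e : (-(s : ℂ) - 1) = ((-s - 1 : ℝ) : ℂ) := by push_cast; ring
    rw [norm_mul, norm_neg, Complex.norm_real, Real.norm_of_nonneg hs.le, e,
      Complex.norm_cpow_real]
    gcongr ?_ * ?_
    exact Real.rpow_le_rpow_of_nonpos (by linarith) hx3 (by linarith)
  · exact ⟨hA, by simp; positivity⟩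
  · exact ⟨hB, by simpa [dist_eq_norm] using h⟩

/-- A uniform Calderón–Zygmund smoothness estimate for the Bergman kernel
over Bergman metric balls. -/
theorem stmt12 (n : ℕ) (hn : 1 ≤ n) (α γ : ℝ) (hα : -1 < α) (hγ : 0 < γ) :
    ∃ C₁ C₂ : ℝ, 0 < C₁ ∧ 0 < C₂ ∧
      ∀ z ∈ uball n, ∀ u ∈ uball n, ∀ ζ ∈ uball n, rho z ζ > C₁ * rho u ζ →
        ∀ w ∈ Dball z γ,
          ‖bergKer α w u - bergKer α w ζ‖ ≤
            C₂ * rho u ζ ^ ((1 : ℝ) / 2) / rho z ζ ^ ((n : ℝ) + 1 + α + 1 / 2) := by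
  obtain ⟨K, hK⟩ : ∃ K : ℝ, K = 3 * (1 + 12 * Real.exp (2 * γ) +
    2 * Real.sqrt (12 * Real.exp (2 * γ))) := ⟨_, rfl⟩
  obtain ⟨s, hs⟩ : ∃ s : ℝ, s = (n : ℝ) + 1 + α := ⟨_, rfl⟩
  have hn0 : (0 : ℝ) ≤ n := by positivity
  have hs0 : 0 < s := by linarith
  have hK0 : 0 < K := by rw [hK]; positivity
  refine ⟨64 * K, s * 2 ^ (s + 1) * 3 * K ^ (s + 1 / 2), by positivity, by positivity, ?_⟩
  intro z hz u hu ζ hζ hR w hw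
  have hz1 : ‖z‖ < 1 := by simpa [uball] using hz
  have hu1 : ‖u‖ < 1 := by simpa [uball] using hu
  have hζ1 : ‖ζ‖ < 1 := by simpa [uball] using hζ
  have hw1 : ‖w‖ < 1 := by simpa [uball] using hw.1
  have hre : ∀ a : En n, ‖a‖ < 1 → 0 < (1 - herm w a).re := by
    intro a ha
    have h1 : ‖herm w a‖ ≤ ‖a‖ * ‖w‖ := by rw [herm_eq]; exact norm_inner_le_norm _ _
    have h2 := Complex.re_le_norm (herm w a)
    simp only [Complex.sub_re, Complex.one_re]
    nlinarith [norm_nonneg a, norm_nonneg w]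
  have hc := compar γ z w ζ hz1 hζ1 hw
  have hrl := rho_le z ζ hz1 hζ1
  have hk := key w u ζ hw1 hu1 hζ1
  have hd0 := rho_nonneg u ζ
  have hreA := hre ζ hζ1
  have hreB := hre u hu1
  have hbk : ∀ a : En n, bergKer α w a = (1 - herm w a) ^ (-(s : ℂ)) := by
    intro a; rw [bergKer, hs]; push_cast; rfl
  rw [hbk, hbk, ← hs]
  have hBA : (1 - herm w u) - (1 - herm w ζ) = -(herm w u - herm w ζ) := by ring
  have hBAn : ‖(1 - herm w u) - (1 - herm w ζ)‖ = ‖herm w u - herm w ζ‖ := by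
    rw [hBA, norm_neg]
  rw [← hBAn] at hk
  set A := 1 - herm w ζ with hA
  set B := 1 - herm w u with hB
  set R := rho z ζ with hRdef
  set d := rho u ζ with hd
  have hA0 : 0 < ‖A‖ := norm_pos_iff.mpr (by intro h; rw [h] at hreA; simp at hreA)
  have hRK : R ≤ K * ‖A‖ := by rw [hK]; linarith
  have hR0 : 0 < R := lt_of_le_of_lt (by positivity) hR
  have hdA : 64 * d ≤ ‖A‖ := by
    have : K * (64 * d) ≤ K * ‖A‖ := by linarith
    exact le_of_mul_le_mul_left this hK0
  set S := Real.sqrt (d * ‖A‖) with hS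
  have hS0 : 0 ≤ S := Real.sqrt_nonneg _
  have hS8 : S ≤ ‖A‖ / 8 := by
    rw [hS, Real.sqrt_le_left (by positivity)]; nlinarith
  have hdS : d ≤ S := Real.le_sqrt_of_sq_le (by nlinarith)
  have hmain := cpow_diff s hs0 A B hreA hreB (by linarith)
  have hSe : S = d ^ ((1 : ℝ) / 2) * ‖A‖ ^ ((1 : ℝ) / 2) := by
    rw [hS, Real.sqrt_eq_rpow, Real.mul_rpow hd0 hA0.le]
  have e1 : (‖A‖ / 2) ^ (-s - 1) = 2 ^ (s + 1) * ‖A‖ ^ (-s - 1) := by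
    rw [Real.div_rpow hA0.le (by norm_num), show -s - 1 = -(s + 1) by ring,
      Real.rpow_neg (by norm_num : (0 : ℝ) ≤ 2)]
    field_simp
  have e2 : ‖A‖ ^ (-s - 1) * ‖A‖ ^ ((1 : ℝ) / 2) = ‖A‖ ^ (-(s + 1 / 2)) := by
    rw [← Real.rpow_add hA0]; congr 1; ring
  have e3 : ‖A‖ ^ (-(s + 1 / 2)) ≤ (R / K) ^ (-(s + 1 / 2)) := by
    apply Real.rpow_le_rpow_of_nonpos (by positivity) _ (by linarith)
    rw [div_le_iff₀ hK0]; linarith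
  have e4 : (R / K) ^ (-(s + 1 / 2)) = K ^ (s + 1 / 2) / R ^ (s + 1 / 2) := by
    rw [Real.rpow_neg (by positivity), Real.div_rpow hR0.le hK0.le, inv_div]
  calc _ ≤ s * (‖A‖ / 2) ^ (-s - 1) * ‖B - A‖ := hmain
    _ ≤ s * (‖A‖ / 2) ^ (-s - 1) * (3 * S) := by gcongr; linarith
    _ = s * 2 ^ (s + 1) * 3 * d ^ ((1 : ℝ) / 2) * (‖A‖ ^ (-s - 1) * ‖A‖ ^ ((1 : ℝ) / 2)) := by
      rw [e1, hSe]; ring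
    _ ≤ s * 2 ^ (s + 1) * 3 * d ^ ((1 : ℝ) / 2) * (K ^ (s + 1 / 2) / R ^ (s + 1 / 2)) := by
      rw [e2, ← e4]; gcongr
    _ = _ := by ring
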